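/- Let m, σ, ε > 0, let q < q' be real numbers, set Δ' = q' - q and q̄ = (q + q')/2, and define the privacy loss function ℓ(y) = log(f_q(y)/f_{q'}(y)). If σ²ε/Δ' ≤ Δ'/2 + m, then the set {y ∈ ℝ : ℓ(y) ≥ ε} equals {y ∈ ℝ : y ≤ q̄ - εσ²/(Δ' + 2m)}. -/

import Mathlib

open MeasureTheory Real Filter Set

/-- The Gaussian Q-function: `Q x = (1/√(2π)) ∫_x^∞ exp (-t²/2) dt`. -/
noncomputable def gaussQ (x : ℝ) : ℝ :=
  (1 / Real.sqrt (2 * Real.pi)) * ∫ t in Set.Ioi x, Real.exp (-t ^ 2 / 2)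

/-- The standard normal CDF: `Φ x = (1/√(2π)) ∫_{-∞}^x exp (-t²/2) dt`. -/
noncomputable def stdPhi (x : ℝ) : ℝ :=
  (1 / Real.sqrt (2 * Real.pi)) * ∫ t in Set.Iic x, Real.exp (-t ^ 2 / 2)

/-- The offset-symmetric Gaussian tails (OSGT) density with parameters `m`, `σ`,
with normalization constant `S = 2√(2πσ²) Q(m/σ)`. -/
noncomputable def osgt (m σ y : ℝ) : ℝ :=
  if y ≤ 0 then
    Real.exp (-(y - m) ^ 2 / (2 * σ ^ 2)) /
      (2 * Real.sqrt (2 * Real.pi * σ ^ 2) * gaussQ (m / σ))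
  else
    Real.exp (-(y + m) ^ 2 / (2 * σ ^ 2)) /
      (2 * Real.sqrt (2 * Real.pi * σ ^ 2) * gaussQ (m / σ))

theorem gaussQ_pos (x : ℝ) : 0 < gaussQ x := by
  have hint : Integrable (fun t : ℝ => Real.exp (-t ^ 2 / 2)) := by
    refine (integrable_exp_neg_mul_sq (b := 1 / 2) (by norm_num)).congr (.of_forall fun t => ?_)
    ring_nf
  refine mul_pos (by positivity) ?_
  rw [setIntegral_pos_iff_support_of_nonneg_ae (.of_forall fun t => (Real.exp_pos _).le)
    hint.integrableOn]
  have hsupp : Function.support (fun t : ℝ => Real.exp (-t ^ 2 / 2)) = Set.univ :=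
    Set.eq_univ_of_forall fun t => (Real.exp_pos _).ne'
  simp [hsupp]

/-- The OSGT density as the exponential of a piecewise quadratic over the normalization. -/
theorem osgt_eq_exp_div (m σ y : ℝ) :
    osgt m σ y = Real.exp (-(if y ≤ 0 then y - m else y + m) ^ 2 / (2 * σ ^ 2)) /
      (2 * Real.sqrt (2 * Real.pi * σ ^ 2) * gaussQ (m / σ)) := by
  unfold osgt
  split_ifs <;> rfl

theorem log_osgt_div_osgt (m : ℝ) {σ : ℝ} (hσ : 0 < σ) (u v : ℝ) :
    Real.log (osgt m σ u / osgt m σ v) =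
      ((if v ≤ 0 then v - m else v + m) ^ 2 - (if u ≤ 0 then u - m else u + m) ^ 2) /
        (2 * σ ^ 2) := by
  have hS : 2 * Real.sqrt (2 * Real.pi * σ ^ 2) * gaussQ (m / σ) ≠ 0 := by
    have := gaussQ_pos (m / σ)
    positivity
  rw [osgt_eq_exp_div, osgt_eq_exp_div, div_div_div_cancel_right₀ hS, ← Real.exp_sub,
    Real.log_exp]
  ring

/-- the privacy-loss level set for the small-`ε` regime. -/
theorem osgt_loss_set_small_eps (m σ ε : ℝ) (hm : 0 < m) (hσ : 0 < σ) (hε : 0 < ε)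
    (q q' : ℝ) (hqq : q < q')
    (Δ' qbar : ℝ) (hΔ' : Δ' = q' - q) (hqbar : qbar = (q + q') / 2)
    (hcase : σ ^ 2 * ε / Δ' ≤ Δ' / 2 + m) :
    {y : ℝ | Real.log (osgt m σ (y - q) / osgt m σ (y - q')) ≥ ε} =
      {y : ℝ | y ≤ qbar - ε * σ ^ 2 / (Δ' + 2 * m)} := by
  ext y
  have hΔ : 0 < Δ' := by linarith
  have hD : 0 < Δ' + 2 * m := by linarith
  have hσ2 : 0 < 2 * σ ^ 2 := by positivity
  rw [div_le_iff₀ hΔ] at hcase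
  have hTpos : 0 < ε * σ ^ 2 / (Δ' + 2 * m) := by positivity
  have hTle : ε * σ ^ 2 / (Δ' + 2 * m) ≤ Δ' / 2 := by
    rw [div_le_iff₀ hD]
    linarith
  simp only [Set.mem_ofPred_eq, ge_iff_le]
  rw [log_osgt_div_osgt m hσ, le_div_iff₀ hσ2]
  rcases le_or_gt (y - q) 0 with hu | hu
  · have hv : y - q' ≤ 0 := by linarith
    rw [if_pos hu, if_pos hv]
    refine iff_of_true ?_ (by linarith)
    have hq' : q' = q + Δ' := by linarith
    subst hq'
    nlinarith [mul_nonneg hΔ.le (neg_nonneg.mpr hu)]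
  · rw [if_neg hu.not_ge]
    rcases le_or_gt (y - q') 0 with hv | hv
    · rw [if_pos hv, le_sub_comm (a := y), div_le_iff₀ hD]
      have hsq : (y - q' - m) ^ 2 - (y - q + m) ^ 2 = 2 * ((qbar - y) * (Δ' + 2 * m)) := by
        rw [hΔ', hqbar]
        ring
      rw [hsq]
      constructor <;> intro h <;> linarith
    · rw [if_neg hv.not_ge]
      refine iff_of_false ?_ (by linarith)
      rw [not_le]
      nlinarith
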